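/- arXiv:2308.10336 — 2 statements merged into one kernel-verified Lean document; each statement's English description precedes it below -/
import Mathlib

section
/- For every smooth function H on ℝ^(2n+2): (i) the cocontact Hamiltonian vector field X^{cc}_H satisfies div(X^{cc}_H) = −(n+1) ∂H/∂z and X^{cc}_H(H) = −H ∂H/∂z; (ii) the cocontact evolution vector field X̄^{cc}_H = X^{cc}_H + ∂/∂t satisfies div(X̄^{cc}_H) = −(n+1) ∂H/∂z and X̄^{cc}_H(H) = ∂H/∂t − H ∂H/∂z; (iii) the energy evolution vector field Ē^{cc}_H satisfies div(Ē^{cc}_H) = −n ∂H/∂z and Ē^{cc}_H(H) = ∂H/∂t. -/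
noncomputable section

/-- The cocontact phase space `ℝ^(2n+2)` with coordinates `(t, q, p, z)`. -/
abbrev Cn (n : ℕ) : Type := ℝ × (Fin n → ℝ) × (Fin n → ℝ) × ℝ

/-- Coordinate direction `∂/∂t` (the Reeb field `R^τ`). -/
def eT (n : ℕ) : Cn n := (1, 0, 0, 0)

/-- Coordinate direction `∂/∂qⁱ`. -/
def eQ (n : ℕ) (i : Fin n) : Cn n := (0, Pi.single i 1, 0, 0)

/-- Coordinate direction `∂/∂pᵢ`. -/
def eP (n : ℕ) (i : Fin n) : Cn n := (0, 0, Pi.single i 1, 0)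

/-- Coordinate direction `∂/∂z` (the Reeb field `R^η`). -/
def eZ (n : ℕ) : Cn n := (0, 0, 0, 1)

/-- Partial derivative of `F` in the direction `v`. -/
def pd {n : ℕ} (F : Cn n → ℝ) (v : Cn n) (x : Cn n) : ℝ := fderiv ℝ F x v

/-- The cocontact Hamiltonian vector field `X^{cc}_H`: `t`-component `0`,
`qⁱ`-component `∂H/∂pᵢ`, `pᵢ`-component `−(∂H/∂qⁱ + pᵢ ∂H/∂z)`,
`z`-component `Σᵢ pᵢ ∂H/∂pᵢ − H`. -/
def Xcc {n : ℕ} (H : Cn n → ℝ) : Cn n → Cn n :=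
  fun x => (0,
            fun i => pd H (eP n i) x,
            fun i => - (pd H (eQ n i) x + x.2.2.1 i * pd H (eZ n) x),
            (∑ i, x.2.2.1 i * pd H (eP n i) x) - H x)

/-- The cocontact evolution vector field `X̄^{cc}_H`: same as `X^{cc}_H` except its
`t`-component is `1`. -/
def XccBar {n : ℕ} (H : Cn n → ℝ) : Cn n → Cn n :=
  fun x => (1,
            fun i => pd H (eP n i) x,
            fun i => - (pd H (eQ n i) x + x.2.2.1 i * pd H (eZ n) x),
            (∑ i, x.2.2.1 i * pd H (eP n i) x) - H x)

/-- The energy evolution vector field `Ē^{cc}_H`: `t`-component `1`,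
`qⁱ`-component `∂H/∂pᵢ`, `pᵢ`-component `−(∂H/∂qⁱ + pᵢ ∂H/∂z)`,
`z`-component `Σᵢ pᵢ ∂H/∂pᵢ`. -/
def EccBar {n : ℕ} (H : Cn n → ℝ) : Cn n → Cn n :=
  fun x => (1,
            fun i => pd H (eP n i) x,
            fun i => - (pd H (eQ n i) x + x.2.2.1 i * pd H (eZ n) x),
            ∑ i, x.2.2.1 i * pd H (eP n i) x)

/-- Coordinate divergence of a vector field on `ℝ^(2n+2)`. -/
def divcc {n : ℕ} (X : Cn n → Cn n) : Cn n → ℝ :=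
  fun x => fderiv ℝ (fun y => (X y).1) x (eT n)
    + (∑ i, fderiv ℝ (fun y => (X y).2.1 i) x (eQ n i))
    + (∑ i, fderiv ℝ (fun y => (X y).2.2.1 i) x (eP n i))
    + fderiv ℝ (fun y => (X y).2.2.2) x (eZ n)

lemma pd_hasFDerivAt {n : ℕ} {H : Cn n → ℝ} (hH : ContDiff ℝ (⊤ : ℕ∞) H) (v x : Cn n) :
    HasFDerivAt (pd H v) ((fderiv ℝ (fderiv ℝ H) x).flip v) x := by
  have h1 : ContDiff ℝ 1 (fderiv ℝ H) :=
    hH.fderiv_right (m := 1) (WithTop.coe_le_coe.2 (le_top : (1 + 1 : ℕ∞) ≤ ⊤))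
  have h2 : HasFDerivAt (fderiv ℝ H) (fderiv ℝ (fderiv ℝ H) x) x :=
    (h1.differentiable (by norm_num) x).hasFDerivAt
  have h3 := h2.clm_apply (hasFDerivAt_const v x)
  refine h3.congr_fderiv ?_
  ext w <;> simp

lemma pd_symm {n : ℕ} {H : Cn n → ℝ} (hH : ContDiff ℝ (⊤ : ℕ∞) H) (v w x : Cn n) :
    fderiv ℝ (pd H v) x w = fderiv ℝ (pd H w) x v := by
  rw [(pd_hasFDerivAt hH v x).fderiv, (pd_hasFDerivAt hH w x).fderiv]
  have h : IsSymmSndFDerivAt ℝ H x := by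
    apply hH.contDiffAt.isSymmSndFDerivAt
    simp only [minSmoothness_of_isRCLikeNormedField]
    exact WithTop.coe_le_coe.2 (le_top : (2 : ℕ∞) ≤ ⊤)
  exact h w v

lemma coordP_hasFDerivAt {n : ℕ} (i : Fin n) (x : Cn n) :
    ∃ L : Cn n →L[ℝ] ℝ, HasFDerivAt (fun y : Cn n => y.2.2.1 i) L x ∧
      ∀ v, L v = v.2.2.1 i := by
  let L : Cn n →L[ℝ] ℝ :=
    (ContinuousLinearMap.proj (R := ℝ) (φ := fun _ : Fin n => ℝ) i).comp
    ((ContinuousLinearMap.fst ℝ (Fin n → ℝ) ℝ).comp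
      ((ContinuousLinearMap.snd ℝ (Fin n → ℝ) ((Fin n → ℝ) × ℝ)).comp
        (ContinuousLinearMap.snd ℝ ℝ ((Fin n → ℝ) × (Fin n → ℝ) × ℝ))))
  exact ⟨L, L.hasFDerivAt, fun v => rfl⟩

lemma mul_pd_diff {n : ℕ} {H : Cn n → ℝ} (hH : ContDiff ℝ (⊤ : ℕ∞) H) (i : Fin n)
    (v x : Cn n) : DifferentiableAt ℝ (fun y : Cn n => y.2.2.1 i * pd H v y) x := by
  obtain ⟨L, hL, -⟩ := coordP_hasFDerivAt i x
  exact (hL.mul (pd_hasFDerivAt hH v x)).differentiableAt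

lemma mul_pd_fderiv {n : ℕ} {H : Cn n → ℝ} (hH : ContDiff ℝ (⊤ : ℕ∞) H) (i : Fin n)
    (v w x : Cn n) : fderiv ℝ (fun y : Cn n => y.2.2.1 i * pd H v y) x w
      = x.2.2.1 i * fderiv ℝ (pd H v) x w + w.2.2.1 i * pd H v x := by
  obtain ⟨L, hL, hv⟩ := coordP_hasFDerivAt i x
  have h := pd_hasFDerivAt hH v x
  rw [(hL.fun_mul h).fderiv, h.fderiv]
  simp [hv, mul_comm]

lemma sum_diff {n : ℕ} {H : Cn n → ℝ} (hH : ContDiff ℝ (⊤ : ℕ∞) H) (x : Cn n) :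
    DifferentiableAt ℝ (fun y : Cn n => ∑ i, y.2.2.1 i * pd H (eP n i) y) x :=
  DifferentiableAt.fun_sum fun i _ => mul_pd_diff hH i _ x

lemma divE {n : ℕ} {H : Cn n → ℝ} (hH : ContDiff ℝ (⊤ : ℕ∞) H) (x : Cn n) :
    divcc (EccBar H) x = -(n : ℝ) * pd H (eZ n) x := by
  have h3 : ∀ i, fderiv ℝ (fun y => (EccBar H y).2.2.1 i) x (eP n i)
      = -(fderiv ℝ (pd H (eP n i)) x (eQ n i) + (x.2.2.1 i * fderiv ℝ (pd H (eP n i)) x (eZ n)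
        + pd H (eZ n) x)) := by
    intro i
    change fderiv ℝ (fun y => -(pd H (eQ n i) y + y.2.2.1 i * pd H (eZ n) y)) x (eP n i) = _
    rw [fderiv_fun_neg, fderiv_fun_add (pd_hasFDerivAt hH _ x).differentiableAt
      (mul_pd_diff hH i _ x)]
    rw [_root_.neg_apply, _root_.add_apply, mul_pd_fderiv hH,
      pd_symm hH (eQ n i), pd_symm hH (eZ n)]
    simp [eP]
  have h4 : fderiv ℝ (fun y => (EccBar H y).2.2.2) x (eZ n)
      = ∑ i, x.2.2.1 i * fderiv ℝ (pd H (eP n i)) x (eZ n) := by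
    change fderiv ℝ (fun y : Cn n => ∑ i, y.2.2.1 i * pd H (eP n i) y) x (eZ n) = _
    rw [fderiv_fun_sum fun i _ => mul_pd_diff hH i _ x, _root_.sum_apply]
    refine Finset.sum_congr rfl fun i _ => ?_
    rw [mul_pd_fderiv hH]
    simp [eZ]
  have h1 : fderiv ℝ (fun y => (EccBar H y).1) x (eT n) = 0 := by
    simp [EccBar]
  have h2 : ∀ i, fderiv ℝ (fun y => (EccBar H y).2.1 i) x (eQ n i)
      = fderiv ℝ (pd H (eP n i)) x (eQ n i) := fun i => rfl
  unfold divcc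
  simp only [h1, h2, h3, h4, Finset.sum_neg_distrib, Finset.sum_add_distrib, Finset.sum_const,
    Finset.card_univ, Fintype.card_fin, nsmul_eq_mul]
  ring

lemma divX {n : ℕ} {H : Cn n → ℝ} (hH : ContDiff ℝ (⊤ : ℕ∞) H) (x : Cn n) :
    divcc (XccBar H) x = -((n : ℝ) + 1) * pd H (eZ n) x := by
  have h4 : fderiv ℝ (fun y => (XccBar H y).2.2.2) x (eZ n)
      = fderiv ℝ (fun y => (EccBar H y).2.2.2) x (eZ n) - pd H (eZ n) x := by
    have hd : DifferentiableAt ℝ H x := hH.differentiable (by simp) x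
    change fderiv ℝ (fun y : Cn n => (∑ i, y.2.2.1 i * pd H (eP n i) y) - H y) x (eZ n) = _
    rw [fderiv_fun_sub (sum_diff hH x) hd]
    rfl
  have h : divcc (XccBar H) x = divcc (EccBar H) x - pd H (eZ n) x := by
    unfold divcc
    rw [h4, ← add_sub_assoc]
    rfl
  rw [h, divE hH]
  ring

lemma vec_decomp {n : ℕ} (v : Cn n) : v = v.1 • eT n + (∑ i, v.2.1 i • eQ n i)
    + (∑ i, v.2.2.1 i • eP n i) + v.2.2.2 • eZ n := by
  obtain ⟨t, q, p, z⟩ := v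
  refine Prod.ext ?_ (Prod.ext ?_ (Prod.ext ?_ ?_)) <;>
    simp [eT, eQ, eP, eZ, Prod.fst_sum, Prod.snd_sum] <;>
    (funext j; simp [Finset.sum_apply, Pi.single_apply])

lemma fderiv_decomp {n : ℕ} (H : Cn n → ℝ) (x v : Cn n) :
    fderiv ℝ H x v = v.1 * pd H (eT n) x + (∑ i, v.2.1 i * pd H (eQ n i) x)
    + (∑ i, v.2.2.1 i * pd H (eP n i) x) + v.2.2.2 * pd H (eZ n) x := by
  conv_lhs => rw [vec_decomp v]
  simp only [map_add, map_sum, map_smul, smul_eq_mul, pd]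

lemma sum_aux {n : ℕ} (a b p : Fin n → ℝ) (c : ℝ) :
    (∑ i, a i * b i) + (∑ i, -(b i + p i * c) * a i) + (∑ i, p i * a i) * c = 0 := by
  rw [Finset.sum_mul, ← Finset.sum_add_distrib, ← Finset.sum_add_distrib]
  exact Finset.sum_eq_zero fun i _ => by ring

/-- Divergences and energy rates of the cocontact Hamiltonian, cocontact evolution,
and energy evolution vector fields. -/
theorem cocontact_fields_divergence_energy (n : ℕ) (H : Cn n → ℝ)
    (hH : ContDiff ℝ (⊤ : ℕ∞) H) :
    ((∀ x, divcc (Xcc H) x = -((n : ℝ) + 1) * pd H (eZ n) x)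
      ∧ (∀ x, fderiv ℝ H x (Xcc H x) = - H x * pd H (eZ n) x))
  ∧ ((∀ x, divcc (XccBar H) x = -((n : ℝ) + 1) * pd H (eZ n) x)
      ∧ (∀ x, fderiv ℝ H x (XccBar H x) = pd H (eT n) x - H x * pd H (eZ n) x))
  ∧ ((∀ x, divcc (EccBar H) x = -(n : ℝ) * pd H (eZ n) x)
      ∧ (∀ x, fderiv ℝ H x (EccBar H x) = pd H (eT n) x)) := by
  refine ⟨⟨fun x => ?_, fun x => ?_⟩, ⟨divX hH, fun x => ?_⟩, ⟨divE hH, fun x => ?_⟩⟩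
  · rw [← divX hH]
    unfold divcc
    have h0 : fderiv ℝ (fun y => (Xcc H y).1) x (eT n)
        = fderiv ℝ (fun y => (XccBar H y).1) x (eT n) := by
      simp [Xcc, XccBar]
    rw [h0]
    rfl
  all_goals
    have h := sum_aux (fun i => pd H (eP n i) x) (fun i => pd H (eQ n i) x) x.2.2.1
      (pd H (eZ n) x)
    rw [fderiv_decomp]
    simp only [Xcc, XccBar, EccBar]
    linear_combination h
end
end

section
/- On ℝ^(2n+2) with coordinates (t, q^i, p_i, z), let Ῡ be a smooth compactly supported one-form with components (Ῡ_t, Ῡ_i, Ῡ^i, Ῡ_z) and H a smooth function. Then the L₂-pairing of Ῡ with the cocontact Hamiltonian vector field X^{cc}_H equals the pairing of H with an explicit density: ∫_{ℝ^(2n+2)} [ Σ_i Ῡ_i ∂H/∂p_i − Σ_i Ῡ^i (∂H/∂q^i + p_i ∂H/∂z) + Ῡ_z (Σ_i p_i ∂H/∂p_i − H) ] dλ = ∫_{ℝ^(2n+2)} H · f(Ῡ) dλ, where f(Ῡ) = Σ_i (∂Ῡ^i/∂q^i − ∂Ῡ_i/∂p_i) − Σ_i p_i (∂Ῡ_z/∂p_i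 − ∂Ῡ^i/∂z) − (n+1) Ῡ_z. This identifies f as the momentum/Poisson map taking one-form densities to (time-dependent dissipative) plasma density functions. -/
open MeasureTheory

noncomputable section

/-- The pointwise pairing `⟨Ῡ, X^{cc}_H⟩` of a one-form with components
`(Ῡ_t, Ῡ_i, Ῡⁱ, Ῡ_z)` with the cocontact Hamiltonian vector field `X^{cc}_H`. -/
def pairXcc {n : ℕ} (Ub : Cn n → Cn n) (H : Cn n → ℝ) : Cn n → ℝ :=
  fun x => (∑ i, (Ub x).2.1 i * pd H (eP n i) x)
    - (∑ i, (Ub x).2.2.1 i * (pd H (eQ n i) x + x.2.2.1 i * pd H (eZ n) x))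
    + (Ub x).2.2.2 * ((∑ i, x.2.2.1 i * pd H (eP n i) x) - H x)

/-- The momentum/Poisson map: the density
`f(Ῡ) = Σᵢ(∂Ῡⁱ/∂qⁱ − ∂Ῡ_i/∂pᵢ) − Σᵢ pᵢ(∂Ῡ_z/∂pᵢ − ∂Ῡⁱ/∂z) − (n+1) Ῡ_z`. -/
def fdensCc {n : ℕ} (Ub : Cn n → Cn n) : Cn n → ℝ :=
  fun x => (∑ i, (fderiv ℝ (fun y => (Ub y).2.2.1 i) x (eQ n i)
        - fderiv ℝ (fun y => (Ub y).2.1 i) x (eP n i)))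
    - (∑ i, x.2.2.1 i * (fderiv ℝ (fun y => (Ub y).2.2.2) x (eP n i)
        - fderiv ℝ (fun y => (Ub y).2.2.1 i) x (eZ n)))
    - ((n : ℝ) + 1) * (Ub x).2.2.2

/-- The integral of a directional derivative of a compactly supported `C^1` function is zero. -/
theorem integral_dir_zero {n : ℕ} (g : Cn n → ℝ) (hg : ContDiff ℝ 1 g)
    (hc : HasCompactSupport g) (v : Cn n) :
    Integrable (fun x => fderiv ℝ g x v) ∧ ∫ x : Cn n, fderiv ℝ g x v = 0 := by
  have h1 : Continuous (fun x => fderiv ℝ g x v) :=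
    (hg.continuous_fderiv one_ne_zero).clm_apply continuous_const
  have h2 : HasCompactSupport (fun x => fderiv ℝ g x v) := hc.fderiv_apply ℝ v
  have hi : Integrable (fun x => fderiv ℝ g x v) := h1.integrable_of_hasCompactSupport h2
  refine ⟨hi, ?_⟩
  have hgi : Integrable g := hg.continuous.integrable_of_hasCompactSupport hc
  haveI h3 : (volume : Measure ((Fin n → ℝ) × ℝ)).IsAddHaarMeasure :=
    Measure.prod.instIsAddHaarMeasure (volume : Measure (Fin n → ℝ)) (volume : Measure ℝ)
  haveI h4 : (volume : Measure ((Fin n → ℝ) × (Fin n → ℝ) × ℝ)).IsAddHaarMeasure :=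
    Measure.prod.instIsAddHaarMeasure (volume : Measure (Fin n → ℝ))
      (volume : Measure ((Fin n → ℝ) × ℝ))
  haveI h5 : (volume : Measure (Cn n)).IsAddHaarMeasure :=
    Measure.prod.instIsAddHaarMeasure (volume : Measure ℝ)
      (volume : Measure ((Fin n → ℝ) × (Fin n → ℝ) × ℝ))
  have := integral_mul_fderiv_eq_neg_fderiv_mul_of_integrable (𝕜 := ℝ) (μ := (volume : Measure (Cn n)))
    (f := fun _ => (1 : ℝ)) (g := g) (v := v) (by simp) (by simpa using hi) (by simpa using hgi)
    (by fun_prop) (fun x _ => hg.differentiable one_ne_zero x)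
  simpa using this

/-- The `L₂`-pairing of a compactly supported one-form `Ῡ` with the cocontact
Hamiltonian vector field `X^{cc}_H` equals the pairing of `H` with the density
`f(Ῡ)`: this identifies `f` as the momentum/Poisson map from one-form densities
to (time-dependent dissipative) plasma density functions. -/
theorem cocontact_momentum_map_pairing (n : ℕ) (H : Cn n → ℝ) (hH : ContDiff ℝ (⊤ : ℕ∞) H)
    (Ub : Cn n → Cn n) (hUb : ContDiff ℝ (⊤ : ℕ∞) Ub) (hUbc : HasCompactSupport Ub) :
    ∫ x : Cn n, pairXcc Ub H x = ∫ x : Cn n, H x * fdensCc Ub x := by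
  have hH1 : ContDiff ℝ 1 H := hH.of_le (by exact_mod_cast le_top)
  have hU1 : ContDiff ℝ 1 Ub := hUb.of_le (by exact_mod_cast le_top)
  have hq : ∀ i, ContDiff ℝ 1 (fun y => (Ub y).2.1 i) := fun i => by fun_prop
  have hp : ∀ i, ContDiff ℝ 1 (fun y => (Ub y).2.2.1 i) := fun i => by fun_prop
  have hz : ContDiff ℝ 1 (fun y => (Ub y).2.2.2) := by fun_prop
  have hP : ∀ i, ContDiff ℝ 1 (fun y : Cn n => y.2.2.1 i) := fun i => by fun_prop
  have hqc : ∀ i, HasCompactSupport (fun y => (Ub y).2.1 i) := fun i =>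
    hUbc.comp_left (g := fun u : Cn n => u.2.1 i) rfl
  have hpc : ∀ i, HasCompactSupport (fun y => (Ub y).2.2.1 i) := fun i =>
    hUbc.comp_left (g := fun u : Cn n => u.2.2.1 i) rfl
  have hzc : HasCompactSupport (fun y => (Ub y).2.2.2) :=
    hUbc.comp_left (g := fun u : Cn n => u.2.2.2) rfl
  have A := fun i => integral_dir_zero (fun y => H y * (Ub y).2.1 i) (hH1.mul (hq i))
    ((hqc i).mul_left) (eP n i)
  have B := fun i => integral_dir_zero (fun y => H y * (Ub y).2.2.1 i) (hH1.mul (hp i))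
    ((hpc i).mul_left) (eQ n i)
  have C := fun i => integral_dir_zero (fun y => (H y * y.2.2.1 i) * (Ub y).2.2.1 i)
    ((hH1.mul (hP i)).mul (hp i)) ((hpc i).mul_left) (eZ n)
  have D := fun i => integral_dir_zero (fun y => (H y * y.2.2.1 i) * (Ub y).2.2.2)
    ((hH1.mul (hP i)).mul hz) (hzc.mul_left) (eP n i)
  have dH := hH1.differentiable one_ne_zero
  have dq := fun i => (hq i).differentiable one_ne_zero
  have dp := fun i => (hp i).differentiable one_ne_zero
  have dz := hz.differentiable one_ne_zero
  have dP := fun i => (hP i).differentiable one_ne_zero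
  have dHP : ∀ i, Differentiable ℝ (fun y : Cn n => H y * y.2.2.1 i) := fun i => dH.mul (dP i)
  have fP : ∀ i (x v : Cn n), fderiv ℝ (fun y : Cn n => y.2.2.1 i) x v = v.2.2.1 i := by
    intro i x v
    exact congrArg (fun L : Cn n →L[ℝ] ℝ => L v) (ContinuousLinearMap.fderiv
      ((ContinuousLinearMap.proj (R := ℝ) (φ := fun _ : Fin n => ℝ) i).comp
        ((ContinuousLinearMap.fst ℝ (Fin n → ℝ) ℝ).comp
          ((ContinuousLinearMap.snd ℝ (Fin n → ℝ) ((Fin n → ℝ) × ℝ)).comp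
            (ContinuousLinearMap.snd ℝ ℝ ((Fin n → ℝ) × (Fin n → ℝ) × ℝ))))) (x := x))
  have fm : ∀ (a b : Cn n → ℝ), Differentiable ℝ a → Differentiable ℝ b → ∀ x v,
      fderiv ℝ (fun y => a y * b y) x v = a x * fderiv ℝ b x v + b x * fderiv ℝ a x v := by
    intro a b ha hb x v
    rw [fderiv_fun_mul (ha x) (hb x)]; simp
  set G : Fin n → Cn n → ℝ := fun i x =>
    fderiv ℝ (fun y => H y * (Ub y).2.1 i) x (eP n i)
    - fderiv ℝ (fun y => H y * (Ub y).2.2.1 i) x (eQ n i)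
    - fderiv ℝ (fun y => (H y * y.2.2.1 i) * (Ub y).2.2.1 i) x (eZ n)
    + fderiv ℝ (fun y => (H y * y.2.2.1 i) * (Ub y).2.2.2) x (eP n i) with hG
  have key : ∀ x, pairXcc Ub H x = H x * fdensCc Ub x + ∑ i, G i x := by
    intro x
    have hn : (n : ℝ) * (Ub x).2.2.2 = ∑ _i : Fin n, (Ub x).2.2.2 := by simp
    have e : ∀ i, G i x =
      (Ub x).2.1 i * pd H (eP n i) x
      - (Ub x).2.2.1 i * (pd H (eQ n i) x + x.2.2.1 i * pd H (eZ n) x)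
      + (Ub x).2.2.2 * (x.2.2.1 i * pd H (eP n i) x)
      - H x * (fderiv ℝ (fun y => (Ub y).2.2.1 i) x (eQ n i)
        - fderiv ℝ (fun y => (Ub y).2.1 i) x (eP n i))
      + H x * (x.2.2.1 i * (fderiv ℝ (fun y => (Ub y).2.2.2) x (eP n i)
        - fderiv ℝ (fun y => (Ub y).2.2.1 i) x (eZ n)))
      + H x * (Ub x).2.2.2 := by
      intro i
      simp only [hG]
      rw [fm _ _ dH (dq i), fm _ _ dH (dp i), fm _ _ (dHP i) (dp i),
        fm _ _ (dHP i) dz, fm _ _ dH (dP i), fm _ _ dH (dP i), fP, fP]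
      simp only [pd, eP, eZ, Pi.single_eq_same, Pi.zero_apply]
      ring
    simp only [e, Finset.sum_add_distrib, Finset.sum_sub_distrib, ← Finset.mul_sum, pairXcc,
      fdensCc]
    simp only [Finset.sum_const, Finset.card_univ, Fintype.card_fin, nsmul_eq_mul]
    ring
  have iG : ∀ i, Integrable (G i) := fun i =>
    (((A i).1.sub (B i).1).sub (C i).1).add (D i).1
  have zG : ∀ i, ∫ x, G i x = 0 := by
    intro i
    simp only [hG]
    have i1 := (A i).1.sub (B i).1
    have i2 := i1.sub (C i).1
    refine (integral_add i2 (D i).1).trans ?_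
    rw [(D i).2, integral_sub' i1 (C i).1, (C i).2, integral_sub' (A i).1 (B i).1,
      (A i).2, (B i).2]
    simp
  have cf : ∀ (a : Cn n → ℝ), ContDiff ℝ 1 a → ∀ v, Continuous (fun x => fderiv ℝ a x v) :=
    fun a ha v => (ha.continuous_fderiv one_ne_zero).clm_apply continuous_const
  have iF : Integrable (fun x => H x * fdensCc Ub x) := by
    apply Continuous.integrable_of_hasCompactSupport
    · have c1 := fun i => cf _ (hp i) (eQ n i)
      have c2 := fun i => cf _ (hq i) (eP n i)
      have c3 := fun i => cf _ hz (eP n i)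
      have c4 := fun i => cf _ (hp i) (eZ n)
      have c5 := hz.continuous
      have c6 := hH1.continuous
      unfold fdensCc
      fun_prop
    · apply HasCompactSupport.mul_left
      refine HasCompactSupport.intro hUbc (fun x hx => ?_)
      have s : ∀ (F : Cn n → ℝ), F 0 = 0 → ∀ v, fderiv ℝ (fun y => F (Ub y)) x v = 0 := by
        intro F hF v
        have : (fun y => F (Ub y)) =ᶠ[nhds x] fun _ => (0 : ℝ) := by
          filter_upwards [(notMem_tsupport_iff_eventuallyEq.mp hx)] with y hy
          simp [hy, hF]
        rw [this.fderiv_eq]; simp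
      have s1 := fun i => s (fun u => u.2.2.1 i) rfl
      have s2 := fun i => s (fun u => u.2.1 i) rfl
      have s3 := s (fun u => u.2.2.2) rfl
      simp [fdensCc, s1, s2, s3, image_eq_zero_of_notMem_tsupport hx]
  simp only [key]
  rw [integral_add iF (integrable_finsetSum _ (fun i _ => iG i)),
    integral_finsetSum _ (fun i _ => iG i)]
  simp [zG]
end
end
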